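/- arXiv:2602.16028 — 2 statements merged into one kernel-verified Lean document; each statement's English description precedes it below -/
import Mathlib

section
/- There is an absolute constant C > 0 such that for every integer n ≥ 4 and every integer d ≥ 2, AQC_{M(n,d)}(q₁, q₂) ≤ C · n² · d; that is, there exist a rewinding strategy A and a time T ≤ C·n²·d for which the total variation distance between D_T^{A,q₁} and D_T^{A,q₂} is at least 1/3. -/
open Finset
open scoped ENNReal

/-- A canonical partially observable Markov chain: a finite state space with a
distinguished absorbing sink state; `P x y` is the probability of moving from `x` to `y`. -/
structure Canonical (Ω : Type) [Fintype Ω] [DecidableEq Ω] where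
  P : Ω → Ω → ℝ
  sink : Ω
  nonneg : ∀ x y, 0 ≤ P x y
  sum_one : ∀ x, ∑ y, P x y = 1
  sink_absorb : P sink sink = 1

variable {Ω : Type} [Fintype Ω] [DecidableEq Ω]

/-- Observation: `true` iff the state is the sink. -/
def Canonical.obs (M : Canonical Ω) (x : Ω) : Bool := decide (x = M.sink)

/-- The observation history `Z₀, …, Z_t` of a state trajectory `g`. -/
def obsHist (M : Canonical Ω) (g : ℕ → Ω) (t : ℕ) : List Bool :=
  (List.range (t + 1)).map fun i => M.obs (g i)

/-- Probability of the state trajectory `g` (conditionally on its initial state `g 0`)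
under rewinding strategy `A`, for `T` steps: at each time `t`, the next state `g (t+1)` is
drawn from the state at time `t - A(Z₀,…,Z_t)` (truncated subtraction realizes `max 0 _`). -/
noncomputable def trajProb (M : Canonical Ω) (A : List Bool → ℕ) (T : ℕ) (g : ℕ → Ω) : ℝ :=
  ∏ t ∈ Finset.range T, M.P (g (t - A (obsHist M g t))) (g (t + 1))

/-- Extend `f : Fin (T+1) → Ω` to `ℕ → Ω` by clamping. -/
def extendTraj {Ω : Type} (T : ℕ) (f : Fin (T + 1) → Ω) : ℕ → Ω :=
  fun n => f ⟨min n T, Nat.lt_succ_of_le (min_le_right n T)⟩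

/-- The probability that the chain `M` with rewinding strategy `A`, started at `x`,
produces the observation sequence `z = (Z₀, …, Z_T)`.  This is the distribution `D_T^{A,x}`. -/
noncomputable def obsSeqProb (M : Canonical Ω) (A : List Bool → ℕ) (x : Ω) (T : ℕ)
    (z : Fin (T + 1) → Bool) : ℝ :=
  ∑ f : Fin (T + 1) → Ω,
    if f 0 = x ∧ (∀ i, M.obs (f i) = z i) then trajProb M A T (extendTraj T f) else 0

/-- Total variation distance between the observation-sequence distributions
`D_T^{A,a}` and `D_T^{A,b}`. -/
noncomputable def obsTV (M : Canonical Ω) (A : List Bool → ℕ) (a b : Ω) (T : ℕ) : ℝ :=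
  (1 / 2) * ∑ z : Fin (T + 1) → Bool, |obsSeqProb M A a T z - obsSeqProb M A b T z|

/-- A rewinding strategy is non-adaptive if it depends only on the length of the history. -/
def NonAdaptive (A : List Bool → ℕ) : Prop :=
  ∀ l₁ l₂ : List Bool, l₁.length = l₂.length → A l₁ = A l₂

/-- Query complexity `QC^A_M(a,b)`: the least `T` with `d_TV(D_T^{A,a}, D_T^{A,b}) ≥ 1/3`,
as an element of `ℝ≥0∞` (`⊤` if no such `T` exists). -/
noncomputable def QC (M : Canonical Ω) (A : List Bool → ℕ) (a b : Ω) : ℝ≥0∞ :=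
  sInf {x : ℝ≥0∞ | ∃ T : ℕ, x = (T : ℝ≥0∞) ∧ 1 / 3 ≤ obsTV M A a b T}

/-- Adaptive query complexity: infimum over all rewinding strategies. -/
noncomputable def AQC (M : Canonical Ω) (a b : Ω) : ℝ≥0∞ :=
  ⨅ A : List Bool → ℕ, QC M A a b

/-- Non-adaptive query complexity: infimum over all non-adaptive rewinding strategies. -/
noncomputable def NAQC (M : Canonical Ω) (a b : Ω) : ℝ≥0∞ :=
  ⨅ A : {A : List Bool → ℕ // NonAdaptive A}, QC M A.1 a b

/-- Transition probabilities of the chain `M(n,d)` (for `4 ≤ n`, `2 ≤ d`).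
States: indices `0, …, n-3` are `q₁, …, q_{n-2}`, index `n-2` is the sink `s`,
and index `n-1` is the dummy state `D`.  A state `qᵢ` stays put with probability
`(1 - 1/d)/2`, moves to the next state (the sink after `q_{n-2}`) with probability
`1/(2d)`, and moves to `D` with probability `1/2`; `D` moves to the sink with
probability `1`, and the sink is absorbing. -/
noncomputable def MndP (n d : ℕ) : Fin n → Fin n → ℝ := fun i j =>
  if (i : ℕ) ≤ n - 3 then
    (if j = i then (1 - 1 / (d : ℝ)) / 2 else 0) +
      (if (j : ℕ) = (i : ℕ) + 1 then 1 / (2 * (d : ℝ)) else 0) +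
      (if (j : ℕ) = n - 1 then 1 / 2 else 0)
  else if (i : ℕ) = n - 1 then (if (j : ℕ) = n - 2 then 1 else 0)
  else (if j = i then 1 else 0)

/-- Expectation of `F` over the trajectories of length `T` started at `x`. -/
noncomputable def trajExp (M : Canonical Ω) (A : List Bool → ℕ) (x : Ω) (T : ℕ)
    (F : (ℕ → Ω) → ℝ) : ℝ :=
  ∑ f : Fin (T + 1) → Ω,
    if f 0 = x then trajProb M A T (extendTraj T f) * F (extendTraj T f) else 0

/-- Replace all values of `g` after time `T` by `y`. -/
def cutTraj {Ω : Type} (T : ℕ) (g : ℕ → Ω) (y : Ω) : ℕ → Ω :=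
  fun i => if i ≤ T then g i else y

lemma obsHist_congr (M : Canonical Ω) {g g' : ℕ → Ω} {t : ℕ} (h : ∀ i ≤ t, g i = g' i) :
    obsHist M g t = obsHist M g' t := by
  unfold obsHist
  refine List.map_congr_left fun i hi => ?_
  rw [h i (by simpa [Nat.lt_succ_iff] using hi)]

lemma trajProb_congr (M : Canonical Ω) (A : List Bool → ℕ) {g g' : ℕ → Ω} {T : ℕ}
    (h : ∀ i ≤ T, g i = g' i) : trajProb M A T g = trajProb M A T g' := by
  unfold trajProb
  refine Finset.prod_congr rfl fun t ht => ?_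
  have ht' := Finset.mem_range.1 ht
  rw [obsHist_congr M (g' := g') fun i hi => h i (by omega), h _ (by omega), h (t + 1) (by omega)]

lemma trajProb_nonneg (M : Canonical Ω) (A : List Bool → ℕ) (T : ℕ) (g : ℕ → Ω) :
    0 ≤ trajProb M A T g :=
  Finset.prod_nonneg fun _ _ => M.nonneg _ _

lemma extendTraj_snoc {Ω : Type} (T : ℕ) (f : Fin (T + 1) → Ω) (y : Ω) :
    extendTraj (T + 1) (Fin.snoc (α := fun _ => Ω) f y) = cutTraj T (extendTraj T f) y := by
  funext i
  unfold extendTraj cutTraj Fin.snoc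
  by_cases h : i ≤ T
  · have h1 : min i (T + 1) < T + 1 := by omega
    have h2 : min i (T + 1) = min i T := by omega
    simp only [h1, h, dite_true, if_true]
    exact congrArg f (Fin.ext h2)
  · have h1 : ¬ min i (T + 1) < T + 1 := by omega
    simp [h1, h]

lemma trajExp_zero (M : Canonical Ω) (A : List Bool → ℕ) (x : Ω) (F : (ℕ → Ω) → ℝ) :
    trajExp M A x 0 F = F fun _ => x := by
  unfold trajExp
  rw [Fintype.sum_eq_single (fun _ => x)]
  · simp [trajProb, extendTraj, Function.const_def]
    rfl
  · intro f hf
    rw [if_neg]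
    intro h
    apply hf
    funext i
    rw [Fin.fin_one_eq_zero i, h]

lemma trajExp_succ (M : Canonical Ω) (A : List Bool → ℕ) (x : Ω) (T : ℕ) (F : (ℕ → Ω) → ℝ) :
    trajExp M A x (T + 1) F = trajExp M A x T fun g =>
      ∑ y, M.P (g (T - A (obsHist M g T))) y * F (cutTraj T g y) := by
  unfold trajExp
  rw [← (Fin.snocEquiv fun _ : Fin (T + 1 + 1) => Ω).sum_comp, Fintype.sum_prod_type_right]
  refine Finset.sum_congr rfl fun f _ => ?_
  have h0 : ∀ y : Ω, (Fin.snocEquiv fun _ : Fin (T + 1 + 1) => Ω) (y, f) 0 = f 0 := fun y =>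
    Fin.snoc_castSucc (α := fun _ => Ω) (n := T + 1) y f 0
  have h1 : ∀ y : Ω, extendTraj (T + 1) ((Fin.snocEquiv fun _ : Fin (T + 1 + 1) => Ω) (y, f)) =
      cutTraj T (extendTraj T f) y := fun y => extendTraj_snoc T f y
  simp only [h0, h1]
  split_ifs
  · rw [Finset.mul_sum]
    refine Finset.sum_congr rfl fun y _ => ?_
    have hc : ∀ i ≤ T, cutTraj T (extendTraj T f) y i = extendTraj T f i := fun i hi => by
      simp [cutTraj, hi]
    have hp : trajProb M A (T + 1) (cutTraj T (extendTraj T f) y) =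
        trajProb M A T (cutTraj T (extendTraj T f) y) *
          M.P (cutTraj T (extendTraj T f) y
            (T - A (obsHist M (cutTraj T (extendTraj T f) y) T)))
            (cutTraj T (extendTraj T f) y (T + 1)) := Finset.prod_range_succ _ _
    rw [hp, trajProb_congr M A hc, obsHist_congr M hc, hc _ (Nat.sub_le _ _)]
    simp [cutTraj, mul_assoc]
  · simp

/-- The trajectory `g` has positive probability up to time `T`. -/
def InSupport (M : Canonical Ω) (A : List Bool → ℕ) (T : ℕ) (g : ℕ → Ω) : Prop :=
  ∀ t < T, M.P (g (t - A (obsHist M g t))) (g (t + 1)) ≠ 0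

lemma trajExp_mono (M : Canonical Ω) (A : List Bool → ℕ) (x : Ω) (T : ℕ)
    {F F' : (ℕ → Ω) → ℝ} (h : ∀ g, g 0 = x → InSupport M A T g → F g ≤ F' g) :
    trajExp M A x T F ≤ trajExp M A x T F' := by
  unfold trajExp
  refine Finset.sum_le_sum fun f _ => ?_
  split_ifs with hf
  · by_cases hp : trajProb M A T (extendTraj T f) = 0
    · simp [hp]
    · refine mul_le_mul_of_nonneg_left (h _ ?_ ?_) (trajProb_nonneg _ _ _ _)
      · rw [← hf]
        exact congrArg f (Fin.ext (by simp))
      · intro t ht h0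
        exact hp (Finset.prod_eq_zero (Finset.mem_range.2 ht) h0)
  · exact le_rfl

lemma trajExp_add (M : Canonical Ω) (A : List Bool → ℕ) (x : Ω) (T : ℕ) (F F' : (ℕ → Ω) → ℝ) :
    trajExp M A x T (fun g => F g + F' g) = trajExp M A x T F + trajExp M A x T F' := by
  unfold trajExp
  rw [← Finset.sum_add_distrib]
  refine Finset.sum_congr rfl fun f _ => ?_
  split_ifs
  · ring
  · ring

lemma trajExp_const_mul (M : Canonical Ω) (A : List Bool → ℕ) (x : Ω) (T : ℕ) (c : ℝ)
    (F : (ℕ → Ω) → ℝ) : trajExp M A x T (fun g => c * F g) = c * trajExp M A x T F := by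
  unfold trajExp
  rw [Finset.mul_sum]
  refine Finset.sum_congr rfl fun f _ => ?_
  split_ifs
  · ring
  · ring

lemma trajExp_one (M : Canonical Ω) (A : List Bool → ℕ) (x : Ω) (T : ℕ) :
    trajExp M A x T (fun _ => 1) = 1 := by
  induction T with
  | zero => rw [trajExp_zero]
  | succ T ih => simpa only [trajExp_succ, mul_one, M.sum_one] using ih

lemma sum_obsSeqProb_mul (M : Canonical Ω) (A : List Bool → ℕ) (x : Ω) (T : ℕ)
    (H : (Fin (T + 1) → Bool) → ℝ) :
    ∑ z, obsSeqProb M A x T z * H z =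
      trajExp M A x T fun g => H fun i => M.obs (g i) := by
  unfold obsSeqProb trajExp
  simp only [Finset.sum_mul]
  rw [Finset.sum_comm]
  refine Finset.sum_congr rfl fun f _ => ?_
  have hf : (fun i : Fin (T + 1) => M.obs (extendTraj T f i)) = fun i => M.obs (f i) := by
    funext i
    have : min (i : ℕ) T = i := by omega
    simp [extendTraj, this]
  rw [hf, Fintype.sum_eq_single (fun i => M.obs (f i))]
  · simp
  · intro z hz
    rw [if_neg, zero_mul]
    rintro ⟨-, h⟩
    exact hz (funext fun i => (h i).symm)

/-- The advantage of any `[0, 1]`-valued test is a lower bound for the total variation. -/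
lemma sub_le_obsTV (M : Canonical Ω) (A : List Bool → ℕ) (a b : Ω) (T : ℕ)
    (H : (Fin (T + 1) → Bool) → ℝ) (h0 : ∀ z, 0 ≤ H z) (h1 : ∀ z, H z ≤ 1) :
    trajExp M A b T (fun g => H fun i => M.obs (g i)) -
      trajExp M A a T (fun g => H fun i => M.obs (g i)) ≤ obsTV M A a b T := by
  have ha := sum_obsSeqProb_mul M A a T fun _ => 1
  have hb := sum_obsSeqProb_mul M A b T fun _ => 1
  rw [trajExp_one] at ha hb
  simp only [mul_one] at ha hb
  rw [← sum_obsSeqProb_mul, ← sum_obsSeqProb_mul]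
  have key : ∑ z, (obsSeqProb M A b T z - obsSeqProb M A a T z) * (2 * H z - 1) ≤
      ∑ z, |obsSeqProb M A a T z - obsSeqProb M A b T z| := by
    refine Finset.sum_le_sum fun z _ => ?_
    rw [abs_sub_comm]
    refine (le_abs_self _).trans ?_
    rw [abs_mul]
    refine mul_le_of_le_one_right (abs_nonneg _) (abs_le.2 ⟨?_, ?_⟩)
    · linarith [h0 z]
    · linarith [h1 z]
  have e : ∑ z, (obsSeqProb M A b T z - obsSeqProb M A a T z) * (2 * H z - 1) =
      2 * (∑ z, obsSeqProb M A b T z * H z - ∑ z, obsSeqProb M A a T z * H z) := by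
    have : ∀ z, (obsSeqProb M A b T z - obsSeqProb M A a T z) * (2 * H z - 1) =
        2 * (obsSeqProb M A b T z * H z) - 2 * (obsSeqProb M A a T z * H z) -
          (obsSeqProb M A b T z - obsSeqProb M A a T z) := fun z => by ring
    simp only [this, Finset.sum_sub_distrib, ← Finset.mul_sum, ha, hb]
    ring
  rw [e] at key
  unfold obsTV
  linarith

/-- The time of the current base state after `r` trials, each consisting of a step from the
base and a step from the state reached: the base returns to time `0` when the sink is reached
directly, is kept when the sink is reached at the second step, and moves forward otherwise. -/
def baseTime (z : ℕ → Bool) : ℕ → ℕ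
  | 0 => 0
  | r + 1 => if z (2 * r + 1) then 0 else if z (2 * r + 2) then baseTime z r else 2 * r + 1

/-- The number of trials among the first `r` in which the sink is reached at the first step. -/
def passCount (z : ℕ → Bool) : ℕ → ℕ
  | 0 => 0
  | r + 1 => passCount z r + if z (2 * r + 1) then 1 else 0

lemma baseTime_le (z : ℕ → Bool) (r : ℕ) : baseTime z r ≤ 2 * r := by
  induction r with
  | zero => simp [baseTime]
  | succ r ih =>
    unfold baseTime
    split_ifs <;> omega

lemma baseTime_congr {z z' : ℕ → Bool} {r : ℕ} (h : ∀ i ≤ 2 * r, z i = z' i) :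
    baseTime z r = baseTime z' r := by
  induction r with
  | zero => rfl
  | succ r ih =>
    simp only [baseTime, h (2 * r + 1) (by omega), h (2 * r + 2) (by omega),
      ih fun i hi => h i (by omega)]

lemma passCount_congr {z z' : ℕ → Bool} {r : ℕ} (h : ∀ i ≤ 2 * r, z i = z' i) :
    passCount z r = passCount z' r := by
  induction r with
  | zero => rfl
  | succ r ih =>
    simp only [passCount, h (2 * r + 1) (by omega), ih fun i hi => h i (by omega)]

/-- The rewinding strategy that samples alternately from the base state and from the state
just reached. -/
def passStrategy (l : List Bool) : ℕ :=
  if (l.length - 1) % 2 = 1 then 0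
  else (l.length - 1) - baseTime (fun i => l.getD i false) ((l.length - 1) / 2)

lemma passStrategy_even (M : Canonical Ω) (g : ℕ → Ω) (r : ℕ) :
    2 * r - passStrategy (obsHist M g (2 * r)) = baseTime (fun i => M.obs (g i)) r := by
  have hl : (obsHist M g (2 * r)).length = 2 * r + 1 := by simp [obsHist]
  have hb : baseTime (fun i => (obsHist M g (2 * r)).getD i false) r =
      baseTime (fun i => M.obs (g i)) r := by
    refine baseTime_congr fun i hi => ?_
    have : i < 2 * r + 1 := by omega
    simp [obsHist, List.getD, this]
  have h1 : (2 * r + 1 - 1) % 2 ≠ 1 := by omega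
  have h2 : (2 * r + 1 - 1) / 2 = r := by omega
  rw [passStrategy, hl, if_neg h1, h2, hb]
  have := baseTime_le (fun i => M.obs (g i)) r
  omega

lemma passStrategy_odd (M : Canonical Ω) (g : ℕ → Ω) (r : ℕ) :
    2 * r + 1 - passStrategy (obsHist M g (2 * r + 1)) = 2 * r + 1 := by
  have hl : (obsHist M g (2 * r + 1)).length = 2 * r + 1 + 1 := by simp [obsHist]
  have h1 : (2 * r + 1 + 1 - 1) % 2 = 1 := by omega
  rw [passStrategy, hl, if_pos h1, Nat.sub_zero]

/-- The base state after `r` trials. -/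
def baseState (M : Canonical Ω) (g : ℕ → Ω) (r : ℕ) : Ω :=
  g (baseTime (fun i => M.obs (g i)) r)

/-- The number of passes completed by the trajectory `g` after `r` trials. -/
def passes (M : Canonical Ω) (g : ℕ → Ω) (r : ℕ) : ℕ :=
  passCount (fun i => M.obs (g i)) r

lemma passes_succ (M : Canonical Ω) (g : ℕ → Ω) (r : ℕ) :
    passes M g (r + 1) = passes M g r + if g (2 * r + 1) = M.sink then 1 else 0 := by
  simp [passes, passCount, Canonical.obs]

lemma baseState_succ (M : Canonical Ω) (g : ℕ → Ω) (r : ℕ) :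
    baseState M g (r + 1) = if g (2 * r + 1) = M.sink then g 0
      else if g (2 * r + 2) = M.sink then baseState M g r else g (2 * r + 1) := by
  simp only [baseState, baseTime, Canonical.obs, decide_eq_true_eq]
  split_ifs <;> rfl

/-- The expectation of a function of the number of passes and the base state obeys a one-trial
recursion. -/
lemma trajExp_trial (M : Canonical Ω) (x : Ω) (r : ℕ) (Φ : ℕ → Ω → ℝ) :
    trajExp M passStrategy x (2 * (r + 1)) (fun g => Φ (passes M g (r + 1)) (baseState M g (r + 1)))
      = trajExp M passStrategy x (2 * r) fun g =>
        ∑ y, M.P (baseState M g r) y * ∑ w, M.P y w *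
          if y = M.sink then Φ (passes M g r + 1) (g 0)
          else if w = M.sink then Φ (passes M g r) (baseState M g r)
          else Φ (passes M g r) y := by
  rw [show 2 * (r + 1) = 2 * r + 1 + 1 by ring, trajExp_succ, trajExp_succ]
  congr 1
  funext g
  rw [passStrategy_even]
  refine Finset.sum_congr rfl fun y _ => congrArg _ (Finset.sum_congr rfl fun w _ => ?_)
  rw [passStrategy_odd]
  have hy : cutTraj (2 * r) g y (2 * r + 1) = y := by simp [cutTraj]
  rw [hy]
  congr 1
  set g' := cutTraj (2 * r + 1) (cutTraj (2 * r) g y) w with hg'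
  have h1 : g' (2 * r + 1) = y := by simp [hg', cutTraj]
  have h2 : g' (2 * r + 2) = w := by simp [hg', cutTraj]
  have h3 : ∀ i ≤ 2 * r, g' i = g i := fun i hi => by
    simp [hg', cutTraj, hi, show i ≤ 2 * r + 1 by omega]
  have hc : passes M g' r = passes M g r := passCount_congr fun i hi => by rw [h3 i hi]
  have hb : baseState M g' r = baseState M g r := by
    unfold baseState
    rw [baseTime_congr (z' := fun i => M.obs (g i)) fun i hi => by rw [h3 i hi]]
    exact h3 _ (baseTime_le _ _)
  rw [passes_succ, baseState_succ, h1, h2, hc, hb, h3 0 (Nat.zero_le _)]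
  split_ifs <;> rfl

section Mnd

variable {n d : ℕ} {M : Canonical (Fin n)}

lemma sum_MndP_q (hn : 4 ≤ n) {i : Fin n} (hi : (i : ℕ) ≤ n - 3) (h : Fin n → ℝ) :
    ∑ j, MndP n d i j * h j = (1 - 1 / (d : ℝ)) / 2 * h i +
      1 / (2 * (d : ℝ)) * h ⟨i + 1, by omega⟩ + 1 / 2 * h ⟨n - 1, by omega⟩ := by
  have h1 : ∀ j : Fin n, ((j : ℕ) = i + 1) ↔ j = ⟨i + 1, by omega⟩ := fun j => by
    simp [Fin.ext_iff]
  have h2 : ∀ j : Fin n, ((j : ℕ) = n - 1) ↔ j = ⟨n - 1, by omega⟩ := fun j => by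
    simp [Fin.ext_iff]
  simp only [MndP, hi, if_true, add_mul, ite_mul, zero_mul, Finset.sum_add_distrib, h1, h2,
    Finset.sum_ite_eq', Finset.mem_univ]

lemma sum_MndP_D (hn : 4 ≤ n) (h : Fin n → ℝ) :
    ∑ j, MndP n d ⟨n - 1, by omega⟩ j * h j = h ⟨n - 2, by omega⟩ := by
  have h1 : ¬ n - 1 ≤ n - 3 := by omega
  have h2 : ∀ j : Fin n, ((j : ℕ) = n - 2) ↔ j = ⟨n - 2, by omega⟩ := fun j => by
    simp [Fin.ext_iff]
  simp only [MndP, h1, if_false, if_true, ite_mul, one_mul, zero_mul, h2,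
    Finset.sum_ite_eq', Finset.mem_univ]

/-- The base state is never the sink nor the dummy state. -/
lemma baseState_le (hn : 4 ≤ n) (hP : M.P = MndP n d) (hs : (M.sink : ℕ) = n - 2)
    {g : ℕ → Fin n} (h0 : (g 0 : ℕ) ≤ n - 3) (r : ℕ)
    (hg : InSupport M passStrategy (2 * r) g) : ((baseState M g r : Fin n) : ℕ) ≤ n - 3 := by
  induction r with
  | zero => exact h0
  | succ r ih =>
    have ih' := ih fun t ht => hg t (by omega)
    have hstep := hg (2 * r + 1) (by omega)
    rw [passStrategy_odd, hP] at hstep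
    rw [baseState_succ]
    split_ifs with h1 h2
    · exact h0
    · exact ih'
    · by_contra hlt
      have e1 : (g (2 * r + 1) : ℕ) ≠ n - 2 := fun h => h1 (Fin.ext (h.trans hs.symm))
      have e2 : (g (2 * r + 2) : ℕ) ≠ n - 2 := fun h => h2 (Fin.ext (h.trans hs.symm))
      have e3 : (g (2 * r + 1) : ℕ) = n - 1 := by omega
      apply hstep
      rw [MndP, if_neg hlt, if_pos e3, if_neg e2]

/-- The expected number of trials needed to complete a pass from state `i`. -/
noncomputable def passTime (n d i : ℕ) : ℝ :=
  ((n : ℝ) - 2 - i) * (2 * d) + if i < n - 3 then 2 * (d : ℝ) / (2 * d - 1) else 0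

lemma passTime_corr_bounds (hd : 2 ≤ d) :
    0 ≤ 2 * (d : ℝ) / (2 * d - 1) ∧ 2 * (d : ℝ) / (2 * d - 1) ≤ 4 / 3 := by
  have hd' : (2 : ℝ) ≤ d := by exact_mod_cast hd
  have : (0 : ℝ) < 2 * d - 1 := by linarith
  refine ⟨by positivity, ?_⟩
  rw [div_le_iff₀ this]
  linarith

lemma passTime_nonneg (hn : 4 ≤ n) (hd : 2 ≤ d) {i : ℕ} (hi : i ≤ n - 3) :
    0 ≤ passTime n d i := by
  have h := (passTime_corr_bounds hd).1
  have hi' : (i : ℝ) + 3 ≤ n := by exact_mod_cast (by omega : i + 3 ≤ n)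
  have : 0 ≤ ((n : ℝ) - 2 - i) * (2 * d) := mul_nonneg (by linarith) (by positivity)
  unfold passTime
  split_ifs <;> linarith

lemma passTime_le_zero (hn : 4 ≤ n) (hd : 2 ≤ d) (i : ℕ) : passTime n d i ≤ passTime n d 0 := by
  have h := (passTime_corr_bounds hd).1
  have : 0 ≤ (i : ℝ) * (2 * d) := by positivity
  have h0 : 0 < n - 3 := by omega
  unfold passTime
  rw [if_pos h0]
  split_ifs <;> push_cast <;> linarith

lemma trial_identity {d : ℝ} (hd : d ≠ 0) (u : ℝ) :
    (1 - 1 / d) / 2 * (u - 1) ^ 2 + 1 / (2 * d) * (u - 1 + 2 * d) ^ 2 + 1 / 2 * (u - 1) ^ 2 =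
      u ^ 2 - 1 + 2 * d := by
  field_simp
  ring

lemma trial_identity_last {d : ℝ} (hd : d ≠ 0) (hd1 : 2 * d - 1 ≠ 0) (u : ℝ) :
    (1 - 1 / d) / 2 * (u - 1) ^ 2 + 1 / (2 * d) *
      ((1 - 1 / d) / 2 * (u - 1 + (2 * d + 2 * d / (2 * d - 1))) ^ 2 + 1 / (2 * d) * (u - 1) ^ 2 +
        1 / 2 * (u - 1 + (2 * d + 2 * d / (2 * d - 1))) ^ 2) + 1 / 2 * (u - 1) ^ 2 =
      u ^ 2 - 1 + (2 * d + 2 * d / (2 * d - 1)) := by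
  have h : 1 / (2 * d) * (1 - 1 / (2 * d)) * (2 * d + 2 * d / (2 * d - 1)) = 1 := by
    field_simp
    ring
  linear_combination (2 * (u - 1) + (2 * d + 2 * d / (2 * d - 1))) * h

/-- One trial increases the centred second moment of the potential by at most `4 d`. -/
lemma trial_second_moment (hn : 4 ≤ n) (hd : 2 ≤ d) (hP : M.P = MndP n d)
    (hs : (M.sink : ℕ) = n - 2) {i : Fin n} (hi : (i : ℕ) ≤ n - 3) (x : Fin n) (N : ℕ) (c : ℝ)
    (Φ : ℕ → Fin n → ℝ)
    (hΦ : ∀ N j, Φ N j = (N * passTime n d x - passTime n d j + (c - 1)) ^ 2) :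
    (∑ y, M.P i y * ∑ w, M.P y w *
        if y = M.sink then Φ (N + 1) x
        else if w = M.sink then Φ N i else Φ N y) ≤
      (N * passTime n d x - passTime n d i + c) ^ 2 + 4 * d := by
  have hd' : (2 : ℝ) ≤ d := by exact_mod_cast hd
  have hd0 : (d : ℝ) ≠ 0 := by positivity
  have hd1 : (2 * (d : ℝ) - 1) ≠ 0 := by linarith
  have hcorr := (passTime_corr_bounds hd).2
  have hsink : ∀ j : Fin n, j = M.sink ↔ (j : ℕ) = n - 2 := fun j => by rw [Fin.ext_iff, hs]
  have hstay : (∑ w, M.P i w * if i = M.sink then Φ (N + 1) x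
      else if w = M.sink then Φ N i else Φ N i) = Φ N i := by
    have : ¬ i = M.sink := by rw [hsink]; omega
    simp only [this, if_false, ite_self, ← Finset.sum_mul, M.sum_one, one_mul]
  have hD : (∑ w, M.P ⟨n - 1, by omega⟩ w * if (⟨n - 1, by omega⟩ : Fin n) = M.sink
      then Φ (N + 1) x else if w = M.sink then Φ N i else Φ N ⟨n - 1, by omega⟩) = Φ N i := by
    have : ¬ (⟨n - 1, by omega⟩ : Fin n) = M.sink := by rw [hsink]; simp only; omega
    rw [hP, sum_MndP_D hn]
    simp only [this, if_false, hsink, if_true]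
  rw [hP] at hstay hD ⊢
  rw [sum_MndP_q hn hi, hstay, hD]
  set u : ℝ := N * passTime n d x - passTime n d i + c with hu
  have hΦi : Φ N i = (u - 1) ^ 2 := by rw [hΦ, hu]; ring
  rw [hΦi]
  by_cases hlast : (i : ℕ) = n - 3
  · have hy : (⟨i + 1, by omega⟩ : Fin n) = M.sink := by rw [hsink]; simp only; omega
    have hpt : passTime n d i = 2 * d := by
      have hc : ((n - 3 : ℕ) : ℝ) = n - 3 := by
        rw [Nat.cast_sub (by omega)]
        norm_num
      rw [hlast, passTime, hc, if_neg (lt_irrefl _)]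
      ring
    have hΦx : Φ (N + 1) x = (u - 1 + 2 * d) ^ 2 := by
      rw [hΦ, hu, hpt]
      push_cast
      ring
    simp only [hy, if_true, ← hP, ← Finset.sum_mul, M.sum_one, one_mul]
    rw [hΦx, trial_identity hd0]
    linarith
  · have hy : ¬ (⟨i + 1, by omega⟩ : Fin n) = M.sink := by rw [hsink]; simp only; omega
    have hyw : ¬ (⟨n - 1, by omega⟩ : Fin n) = M.sink := by rw [hsink]; simp only; omega
    have hlt : (i : ℕ) < n - 3 := by omega
    rw [sum_MndP_q hn (i := ⟨i + 1, by omega⟩) (by simp only; omega)]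
    simp only [hy, hyw, if_false]
    by_cases hpen : (i : ℕ) + 1 = n - 3
    · have hw : (⟨i + 1 + 1, by omega⟩ : Fin n) = M.sink := by rw [hsink]; simp only; omega
      have hΦy : Φ N ⟨i + 1, by omega⟩ = (u - 1 + (2 * d + 2 * d / (2 * d - 1))) ^ 2 := by
        rw [hΦ, hu]
        simp only [passTime, hlt, if_true, hpen, lt_irrefl, if_false]
        rw [← hpen]
        push_cast
        ring
      simp only [hw, if_true]
      rw [hΦy, trial_identity_last hd0 hd1]
      linarith
    · have hw : ¬ (⟨i + 1 + 1, by omega⟩ : Fin n) = M.sink := by rw [hsink]; simp only; omega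
      have hlt' : (i : ℕ) + 1 < n - 3 := by omega
      have hΦy : Φ N ⟨i + 1, by omega⟩ = (u - 1 + 2 * d) ^ 2 := by
        rw [hΦ, hu]
        simp only [passTime, hlt, hlt', if_true]
        push_cast
        ring
      simp only [hw, if_false]
      have e : ∀ X : ℝ, (1 - 1 / (d : ℝ)) / 2 * X + 1 / (2 * (d : ℝ)) * X + 1 / 2 * X = X :=
        fun X => by
          field_simp
          ring
      rw [e, hΦy, trial_identity hd0]
      linarith

/-- The potential `passes * passTime x - passTime base + passTime x` concentrates around the
number of trials. -/
lemma potential_second_moment (hn : 4 ≤ n) (hd : 2 ≤ d) (hP : M.P = MndP n d)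
    (hs : (M.sink : ℕ) = n - 2) {x : Fin n} (hx : (x : ℕ) ≤ n - 3) (r : ℕ) :
    (trajExp M passStrategy x (2 * r) fun g => (passes M g r * passTime n d x -
      passTime n d (baseState M g r : Fin n) + (passTime n d x - r)) ^ 2) ≤ 4 * d * r := by
  induction r with
  | zero =>
    rw [Nat.mul_zero, trajExp_zero]
    simp [passes, passCount, baseState]
  | succ r ih =>
    refine (trajExp_trial M x r fun N j => (N * passTime n d x -
      passTime n d j + (passTime n d x - (r + 1 : ℕ))) ^ 2).le.trans ?_
    refine (trajExp_mono M passStrategy x (2 * r) (F' := fun g => (passes M g r * passTime n d x -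
      passTime n d (baseState M g r : Fin n) + (passTime n d x - r)) ^ 2 + 4 * d * 1) ?_).trans ?_
    · intro g hg hsupp
      rw [hg, mul_one]
      refine trial_second_moment hn hd hP hs
        (baseState_le hn hP hs (by rwa [hg]) r hsupp) x _ _
        (fun N j => (N * passTime n d x - passTime n d j + (passTime n d x - (r + 1 : ℕ))) ^ 2) ?_
      intro N j
      push_cast
      ring
    · rw [trajExp_add, trajExp_const_mul, trajExp_one]
      push_cast
      linarith

/-- Chebyshev bound: an event forcing the potential to be at least `δ` away from its mean. -/
lemma trajExp_indicator_le (hn : 4 ≤ n) (hd : 2 ≤ d) (hP : M.P = MndP n d)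
    (hs : (M.sink : ℕ) = n - 2) {x : Fin n} (hx : (x : ℕ) ≤ n - 3) (r : ℕ) (S : ℕ → Prop)
    [DecidablePred S] {δ : ℝ} (hδ : 0 < δ)
    (hS : ∀ (N : ℕ) (j : Fin n), (j : ℕ) ≤ n - 3 → S N →
      δ ≤ |N * passTime n d x - passTime n d j + (passTime n d x - r)|) :
    trajExp M passStrategy x (2 * r) (fun g => if S (passes M g r) then 1 else 0) ≤
      4 * d * r / δ ^ 2 := by
  rw [le_div_iff₀ (by positivity), mul_comm, ← trajExp_const_mul]
  refine (trajExp_mono _ _ _ _ fun g hg hsupp => ?_).trans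
    (potential_second_moment hn hd hP hs hx r)
  have hb := baseState_le hn hP hs (by rwa [hg]) r hsupp
  split_ifs with h
  · rw [mul_one, ← sq_abs (_ + _)]
    exact pow_le_pow_left₀ hδ.le (hS _ _ hb h) 2
  · rw [mul_zero]
    positivity

/-- With `216 n` passes the strategy distinguishes the first two states. -/
lemma one_third_le_obsTV (hn : 4 ≤ n) (hd : 2 ≤ d) (hP : M.P = MndP n d)
    (hs : (M.sink : ℕ) = n - 2) {a b : Fin n} (ha : (a : ℕ) = 0) (hb : (b : ℕ) = 1) :
    1 / 3 ≤ obsTV M passStrategy a b (2 * (216 * n * d * (2 * n - 5))) := by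
  set R := 216 * n * d * (2 * n - 5) with hR
  have hd' : (2 : ℝ) ≤ d := by exact_mod_cast hd
  have hn' : (4 : ℝ) ≤ n := by exact_mod_cast hn
  have hRc : (R : ℝ) = 216 * n * d * (2 * n - 5) := by
    rw [hR]
    push_cast [Nat.cast_sub (show 5 ≤ 2 * n by omega)]
    ring
  obtain ⟨hc0, hc1⟩ := passTime_corr_bounds hd
  have hpa : 2 * (d : ℝ) * (n - 2) ≤ passTime n d a := by
    rw [ha, passTime]
    split_ifs <;> push_cast <;> linarith
  have hpb : passTime n d b ≤ 2 * (d : ℝ) * (n - 3) + 4 / 3 := by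
    rw [hb, passTime]
    split_ifs <;> push_cast <;> linarith
  have hnd : 0 < (n : ℝ) * d := by positivity
  have hδ : 0 < 72 * ((n : ℝ) * d) := by positivity
  have hbound : 4 * d * R / (72 * ((n : ℝ) * d)) ^ 2 ≤ 1 / 3 := by
    rw [hRc, div_le_iff₀ (by positivity)]
    have : 0 ≤ (n : ℝ) * d ^ 2 := by positivity
    nlinarith
  have hA := trajExp_indicator_le hn hd hP hs (x := a) (by omega) R (fun N => 216 * n ≤ N) hδ
    (by
      intro N j _ hN
      have hN' : 216 * (n : ℝ) ≤ N := by exact_mod_cast hN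
      have h1 : passTime n d j ≤ passTime n d a := ha ▸ passTime_le_zero hn hd j
      have h2 : 216 * (n : ℝ) * (2 * d * (n - 2)) ≤ N * passTime n d a :=
        mul_le_mul hN' hpa (mul_nonneg (by positivity) (by linarith)) (by positivity)
      refine le_trans ?_ (le_abs_self _)
      rw [hRc]
      nlinarith)
  have hB := trajExp_indicator_le hn hd hP hs (x := b) (by omega) R (fun N => ¬ 216 * n ≤ N) hδ
    (by
      intro N j hj hN
      have hN' : (N : ℝ) + 1 ≤ 216 * n := by exact_mod_cast (by omega : N + 1 ≤ 216 * n)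
      have h1 : 0 ≤ passTime n d j := passTime_nonneg hn hd hj
      have h2 : ((N : ℝ) + 1) * passTime n d b ≤ 216 * n * (2 * d * (n - 3) + 4 / 3) :=
        mul_le_mul hN' hpb (passTime_nonneg hn hd (by omega)) (by positivity)
      refine le_trans ?_ (neg_le_abs _)
      rw [hRc]
      nlinarith)
  have hsum : trajExp M passStrategy b (2 * R)
        (fun g => if 216 * n ≤ passes M g R then 1 else 0) +
      trajExp M passStrategy b (2 * R)
        (fun g => if ¬ 216 * n ≤ passes M g R then 1 else 0) = 1 := by
    rw [← trajExp_add]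
    refine Eq.trans ?_ (trajExp_one M passStrategy b (2 * R))
    congr 1
    funext g
    split_ifs <;> norm_num
  let H : (Fin (2 * R + 1) → Bool) → ℝ := fun z =>
    if 216 * n ≤ passCount (fun i => if h : i < 2 * R + 1 then z ⟨i, h⟩ else false) R then 1 else 0
  have hH : ∀ g : ℕ → Fin n, H (fun i => M.obs (g i)) =
      if 216 * n ≤ passes M g R then 1 else 0 := fun g => by
    have : passCount (fun i => if h : i < 2 * R + 1 then M.obs (g i) else false) R =
        passes M g R := passCount_congr fun i hi => by
      rw [dif_pos (by omega)]
    simp only [H, this]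
  have htest := sub_le_obsTV M passStrategy a b (2 * R) H
    (fun z => by simp only [H]; split_ifs <;> norm_num)
    (fun z => by simp only [H]; split_ifs <;> norm_num)
  simp only [hH] at htest
  linarith

end Mnd

theorem stmt_3 :
    ∃ C : ℝ, 0 < C ∧
      ∀ n d : ℕ, 4 ≤ n → 2 ≤ d →
        ∀ M : Canonical (Fin n), M.P = MndP n d → (M.sink : ℕ) = n - 2 →
          ∀ q1 q2 : Fin n, (q1 : ℕ) = 0 → (q2 : ℕ) = 1 →
            AQC M q1 q2 ≤ ENNReal.ofReal (C * (n : ℝ) ^ 2 * d) ∧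
            ∃ (A : List Bool → ℕ) (T : ℕ),
              (T : ℝ) ≤ C * (n : ℝ) ^ 2 * d ∧ 1 / 3 ≤ obsTV M A q1 q2 T := by
  refine ⟨864, by norm_num, fun n d hn hd M hP hs q1 q2 h1 h2 => ?_⟩
  have hTV := one_third_le_obsTV hn hd hP hs h1 h2
  have hT : ((2 * (216 * n * d * (2 * n - 5)) : ℕ) : ℝ) ≤ 864 * (n : ℝ) ^ 2 * d := by
    have : 2 * (216 * n * d * (2 * n - 5)) ≤ 864 * n ^ 2 * d := by
      calc 2 * (216 * n * d * (2 * n - 5)) ≤ 2 * (216 * n * d * (2 * n)) := by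
            gcongr
            omega
        _ = 864 * n ^ 2 * d := by ring
    exact_mod_cast this
  refine ⟨?_, passStrategy, _, hT, hTV⟩
  refine (iInf_le _ passStrategy).trans (le_trans (sInf_le ⟨_, rfl, hTV⟩) ?_)
  rw [← ENNReal.ofReal_natCast]
  exact ENNReal.ofReal_le_ofReal hT
end

section
/- Let Ω be a finite set with |Ω| = n ≥ 2, let P assign to each x ∈ Ω a probability distribution P(·|x) on Ω, let 𝒫 be a partition of Ω, and let h > 0. Suppose that every partition 𝒫' that refines 𝒫 and separates at least one pair of states lying in a common class of 𝒫 satisfies w(𝒫, 𝒫') > h. Then every pair of states a, b ∈ Ω with 𝒫(a) = 𝒫(b) satisfies d_TV^𝒫(a,b) < (n−1)/√h. -/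
open Finset
open scoped ENNReal

/-- A partition of a finite type `Ω`, given by the map sending each element to its class. -/
structure Partn (Ω : Type) [Fintype Ω] [DecidableEq Ω] where
  cls : Ω → Finset Ω
  mem_cls : ∀ x, x ∈ cls x
  cls_eq : ∀ x y, y ∈ cls x → cls y = cls x

/-- `probOf P x C = P(C|x)`, the probability that the next state after `x` lies in `C`. -/
noncomputable def probOf {Ω : Type} [Fintype Ω] (P : Ω → Ω → ℝ) (x : Ω) (C : Finset Ω) : ℝ :=
  ∑ y ∈ C, P x y

/-- Projected total variation distance `d_TV^Pt(a,b)`. -/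
noncomputable def dTVP {Ω : Type} [Fintype Ω] [DecidableEq Ω] (P : Ω → Ω → ℝ)
    (Pt : Partn Ω) (a b : Ω) : ℝ :=
  (1 / 2) * ∑ C ∈ Finset.univ.image Pt.cls, |probOf P a C - probOf P b C|

/-- `Pt'` refines `Pt` if every class of `Pt'` is contained in a class of `Pt`. -/
def Refines {Ω : Type} [Fintype Ω] [DecidableEq Ω] (Pt' Pt : Partn Ω) : Prop :=
  ∀ x, Pt'.cls x ⊆ Pt.cls x

/-- The weight `w(Pt,Pt')`: the maximum of `1/d_TV^Pt(x,y)²` over pairs `x, y` lying in the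
same class of `Pt` but different classes of `Pt'` (valued in `ℝ≥0∞`; `1/0 = ⊤`). -/
noncomputable def wgt {Ω : Type} [Fintype Ω] [DecidableEq Ω] (P : Ω → Ω → ℝ)
    (Pt Pt' : Partn Ω) : ℝ≥0∞ :=
  ⨆ (x : Ω) (y : Ω) (_ : Pt.cls x = Pt.cls y ∧ Pt'.cls x ≠ Pt'.cls y),
    (ENNReal.ofReal ((dTVP P Pt x y) ^ 2))⁻¹

theorem dTVP_self {Ω : Type} [Fintype Ω] [DecidableEq Ω] (P : Ω → Ω → ℝ) (Pt : Partn Ω) (a : Ω) :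
    dTVP P Pt a a = 0 := by
  simp [dTVP]

theorem dTVP_comm {Ω : Type} [Fintype Ω] [DecidableEq Ω] (P : Ω → Ω → ℝ) (Pt : Partn Ω)
    (a b : Ω) : dTVP P Pt a b = dTVP P Pt b a := by
  simp only [dTVP, abs_sub_comm]

theorem dTVP_triangle {Ω : Type} [Fintype Ω] [DecidableEq Ω] (P : Ω → Ω → ℝ) (Pt : Partn Ω)
    (a b c : Ω) : dTVP P Pt a c ≤ dTVP P Pt a b + dTVP P Pt b c := by
  unfold dTVP
  rw [← mul_add, ← Finset.sum_add_distrib]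
  gcongr
  exact abs_sub_le _ _ _

/-- Pairs of distinct states in a common class of `Pt` at projected distance less than `r`. -/
def closeGraph {Ω : Type} [Fintype Ω] [DecidableEq Ω] (P : Ω → Ω → ℝ) (Pt : Partn Ω) (r : ℝ) :
    SimpleGraph Ω where
  Adj x y := x ≠ y ∧ Pt.cls x = Pt.cls y ∧ dTVP P Pt x y < r
  symm := ⟨fun x y h => ⟨h.1.symm, h.2.1.symm, dTVP_comm P Pt x y ▸ h.2.2⟩⟩
  loopless := ⟨fun _ h => h.1 rfl⟩

theorem dTVP_le_of_walk {Ω : Type} [Fintype Ω] [DecidableEq Ω] {P : Ω → Ω → ℝ} {Pt : Partn Ω}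
    {r : ℝ} {a b : Ω} (p : (closeGraph P Pt r).Walk a b) : dTVP P Pt a b ≤ p.length * r := by
  induction p with
  | nil => simp [dTVP_self]
  | @cons u v w e q ih =>
    have := dTVP_triangle P Pt u v w
    have := e.2.2
    rw [SimpleGraph.Walk.length_cons]
    push_cast
    linarith

theorem cls_eq_of_walk {Ω : Type} [Fintype Ω] [DecidableEq Ω] {P : Ω → Ω → ℝ} {Pt : Partn Ω}
    {r : ℝ} {a b : Ω} (p : (closeGraph P Pt r).Walk a b) : Pt.cls a = Pt.cls b := by
  induction p with
  | nil => rfl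
  | cons e _ ih => exact e.2.1.trans ih

open Classical in
/-- The partition of the vertices of a graph into connected components. -/
noncomputable def componentPartn {Ω : Type} [Fintype Ω] [DecidableEq Ω] (G : SimpleGraph Ω) :
    Partn Ω where
  cls x := Finset.univ.filter (G.Reachable x)
  mem_cls x := by simp
  cls_eq x y hxy := by
    have hr : G.Reachable x y := by simpa using hxy
    ext z
    simpa using ⟨hr.trans, hr.symm.trans⟩

theorem componentPartn_cls_eq_iff {Ω : Type} [Fintype Ω] [DecidableEq Ω] (G : SimpleGraph Ω)
    (x y : Ω) : (componentPartn G).cls x = (componentPartn G).cls y ↔ G.Reachable x y := by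
  constructor
  · intro h
    have hy := h ▸ (componentPartn G).mem_cls y
    simpa [componentPartn] using hy
  · intro h
    exact ((componentPartn G).cls_eq x y (by simpa [componentPartn] using h)).symm

theorem refines_componentPartn {Ω : Type} [Fintype Ω] [DecidableEq Ω] (P : Ω → Ω → ℝ)
    (Pt : Partn Ω) (r : ℝ) : Refines (componentPartn (closeGraph P Pt r)) Pt := by
  intro x y hy
  have hr : (closeGraph P Pt r).Reachable x y := by simpa [componentPartn] using hy
  obtain ⟨p⟩ := hr
  rw [cls_eq_of_walk p]
  exact Pt.mem_cls y

theorem lt_inv_sqrt_of_ofReal_lt_inv {h d : ℝ} (hh : 0 < h)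
    (hlt : ENNReal.ofReal h < (ENNReal.ofReal (d ^ 2))⁻¹) : d < 1 / Real.sqrt h := by
  rw [ENNReal.lt_inv_iff_lt_inv, ← ENNReal.ofReal_inv_of_pos hh,
    ENNReal.ofReal_lt_ofReal_iff (inv_pos.2 hh)] at hlt
  rw [one_div, ← Real.sqrt_inv]
  exact Real.lt_sqrt_of_sq_lt hlt

theorem stmt_6 {Ω : Type} [Fintype Ω] [DecidableEq Ω] (n : ℕ) (hn : 2 ≤ n)
    (hcard : Fintype.card Ω = n)
    (P : Ω → Ω → ℝ) (hP0 : ∀ x y, 0 ≤ P x y) (hP1 : ∀ x, ∑ y, P x y = 1)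
    (Pt : Partn Ω) (h : ℝ) (hh : 0 < h)
    (hyp : ∀ Pt' : Partn Ω, Refines Pt' Pt →
      (∃ x y : Ω, Pt.cls x = Pt.cls y ∧ Pt'.cls x ≠ Pt'.cls y) →
      ENNReal.ofReal h < wgt P Pt Pt') :
    ∀ a b : Ω, Pt.cls a = Pt.cls b → dTVP P Pt a b < ((n : ℝ) - 1) / Real.sqrt h := by
  intro a b hab
  have hn' : (2 : ℝ) ≤ n := by exact_mod_cast hn
  have hs : 0 < Real.sqrt h := Real.sqrt_pos.2 hh
  have hreach : (closeGraph P Pt (1 / Real.sqrt h)).Reachable a b := by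
    by_contra hsep
    have hw := hyp _ (refines_componentPartn P Pt (1 / Real.sqrt h))
      ⟨a, b, hab, fun e => hsep ((componentPartn_cls_eq_iff _ a b).1 e)⟩
    simp only [wgt, lt_iSup_iff] at hw
    obtain ⟨x, y, ⟨hxy, hne⟩, hlt⟩ := hw
    refine hne ((componentPartn_cls_eq_iff _ x y).2 (SimpleGraph.Adj.reachable ?_))
    exact ⟨fun e => hne (e ▸ rfl), hxy, lt_inv_sqrt_of_ofReal_lt_inv hh hlt⟩
  obtain ⟨p, hp⟩ := hreach.exists_isPath
  have hlen : p.length + 1 ≤ n := hcard ▸ hp.length_lt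
  cases p with
  | nil =>
    rw [dTVP_self]
    exact div_pos (by linarith) hs
  | @cons _ v _ e q =>
    rw [SimpleGraph.Walk.length_cons] at hlen
    have hlen' : (q.length : ℝ) + 1 ≤ n - 1 := by
      have : ((q.length + 1 + 1 : ℕ) : ℝ) ≤ n := by exact_mod_cast hlen
      push_cast at this
      linarith
    calc dTVP P Pt a b ≤ dTVP P Pt a v + dTVP P Pt v b := dTVP_triangle P Pt a v b
      _ < 1 / Real.sqrt h + q.length * (1 / Real.sqrt h) :=
        add_lt_add_of_lt_of_le e.2.2 (dTVP_le_of_walk q)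
      _ = (q.length + 1) / Real.sqrt h := by ring
      _ ≤ ((n : ℝ) - 1) / Real.sqrt h := by gcongr
end
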